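/- Assume the structure hypotheses (H), suppose G can be tiled with K_{s,t}, and let ℱ be a K_{s,t}-tiling of G that minimizes the number of crossing copies of K_{s,t}. Then for i = 1,2: if ℱ contains a Type 2 crossing K_{s,t} from U_i or from V_i, then ℱ contains no Type 2 crossing K_{s,t} from U_{3−i} or from V_{3−i}. -/

import Mathlib

open scoped Classical
open Finset

namespace PaperTiling

variable {V : Type*} [Fintype V] [DecidableEq V]

/-- The number of neighbours of `v` inside the set `S`. -/
noncomputable def degS (G : SimpleGraph V) (v : V) (S : Finset V) : ℕ :=
  (S.filter fun w => G.Adj v w).card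

/-- The number of edges of `G` with one end in `A` and the other in `B`. -/
noncomputable def eAB (G : SimpleGraph V) (A B : Finset V) : ℕ :=
  ∑ v ∈ A, degS G v B

/-- The edge density `d(A,B) = e(A,B)/(|A||B|)`. -/
noncomputable def dens (G : SimpleGraph V) (A B : Finset V) : ℝ :=
  (eAB G A B : ℝ) / ((A.card : ℝ) * (B.card : ℝ))

/-- `G` is a bipartite graph with parts `A` and `B`. -/
def IsBipartition (G : SimpleGraph V) (A B : Finset V) : Prop :=
  Disjoint A B ∧ A ∪ B = Finset.univ ∧
    ∀ u v : V, G.Adj u v → (u ∈ A ∧ v ∈ B) ∨ (u ∈ B ∧ v ∈ A)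

/-- `(S, T)` spans a copy of the complete bipartite graph `K_{s,t}` in `G`,
with `S` the side of size `s` and `T` the side of size `t`. -/
def IsKst (G : SimpleGraph V) (s t : ℕ) (S T : Finset V) : Prop :=
  Disjoint S T ∧ S.card = s ∧ T.card = t ∧ ∀ u ∈ S, ∀ v ∈ T, G.Adj u v

/-- `𝒯` is a perfect `K_{s,t}`-tiling of `G`: a collection of pairwise
vertex-disjoint copies of `K_{s,t}` covering all vertices. -/
def IsKstTiling (G : SimpleGraph V) (s t : ℕ)
    (𝒯 : Finset (Finset V × Finset V)) : Prop :=
  (∀ P ∈ 𝒯, IsKst G s t P.1 P.2) ∧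
  (𝒯 : Set (Finset V × Finset V)).PairwiseDisjoint (fun P => P.1 ∪ P.2) ∧
  𝒯.sup (fun P => P.1 ∪ P.2) = Finset.univ

/-- `G` can be tiled with `K_{s,t}`. -/
def KstTileable (G : SimpleGraph V) (s t : ℕ) : Prop :=
  ∃ 𝒯 : Finset (Finset V × Finset V), IsKstTiling G s t 𝒯

/-- `G` can be tiled with the complete graph `K_s`. -/
def CliqueTileable (G : SimpleGraph V) (s : ℕ) : Prop :=
  ∃ 𝒞 : Finset (Finset V),
    (∀ S ∈ 𝒞, S.card = s ∧ G.IsClique (S : Set V)) ∧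
    (𝒞 : Set (Finset V)).PairwiseDisjoint id ∧
    𝒞.sup id = Finset.univ

/-- The minimum degree of `G` equals the real number `c`. -/
def MinDegreeIs (G : SimpleGraph V) (c : ℝ) : Prop :=
  (∀ v : V, c ≤ (degS G v Finset.univ : ℝ)) ∧
  ∃ v : V, (degS G v Finset.univ : ℝ) = c

/-- `(c, L)` is an `h`-star with centre `c ∈ A` and `h` leaves `L ⊆ B`. -/
def IsStar (G : SimpleGraph V) (h : ℕ) (A B : Finset V) (c : V) (L : Finset V) : Prop :=
  c ∈ A ∧ L ⊆ B ∧ L.card = h ∧ ∀ v ∈ L, G.Adj c v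

/-- `𝒮` is a family of pairwise vertex-disjoint `h`-stars from `A` to `B`. -/
def StarFamily (G : SimpleGraph V) (h : ℕ) (A B : Finset V)
    (𝒮 : Finset (V × Finset V)) : Prop :=
  (∀ S ∈ 𝒮, IsStar G h A B S.1 S.2) ∧
  (𝒮 : Set (V × Finset V)).PairwiseDisjoint (fun S => insert S.1 S.2)

/-- The structure hypotheses (H) for the extremal construction of the paper:
`1 ≤ s < t`, `t ≥ 2s+1`, `k ≥ 1`, `G` is bipartite with parts
`U₀ ∪ U₁ ∪ U₂` and `V₀ ∪ V₁ ∪ V₂`, with the prescribed part sizes,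
complete pairs `(U₁,V₁)`, `(U₂,V₂)`, `(U₀, V₁∪V₂)`, `(V₀, U₁∪U₂)`,
no edges between `U₀` and `V₀`, and sparse `K_{2,2}`-free diagonal pairs. -/
structure StructH (G : SimpleGraph V) (s t k : ℕ)
    (U0 U1 U2 V0 V1 V2 : Finset V) : Prop where
  hs : 1 ≤ s
  hst : s < t
  ht : 2 * s + 1 ≤ t
  hk : 1 ≤ k
  bip : IsBipartition G (U0 ∪ U1 ∪ U2) (V0 ∪ V1 ∪ V2)
  hU01 : Disjoint U0 U1
  hU02 : Disjoint U0 U2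
  hU12 : Disjoint U1 U2
  hV01 : Disjoint V0 V1
  hV02 : Disjoint V0 V2
  hV12 : Disjoint V1 V2
  cardU0 : U0.card = s - 1
  cardV0 : V0.card = s - 1
  cardU1 : U1.card = k * (s + t) + (t + 1) / 2
  cardV2 : V2.card = k * (s + t) + (t + 1) / 2
  cardV1 : V1.card = k * (s + t) + (t + 2) / 2
  cardU2 : U2.card = k * (s + t) + (t + 2) / 2
  compU1V1 : ∀ u ∈ U1, ∀ v ∈ V1, G.Adj u v
  compU2V2 : ∀ u ∈ U2, ∀ v ∈ V2, G.Adj u v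
  compU0 : ∀ u ∈ U0, ∀ v ∈ V1 ∪ V2, G.Adj u v
  compV0 : ∀ v ∈ V0, ∀ u ∈ U1 ∪ U2, G.Adj u v
  emptyU0V0 : ∀ u ∈ U0, ∀ v ∈ V0, ¬ G.Adj u v
  K22freeU1V2 : ∀ S T : Finset V, S ⊆ U1 → T ⊆ V2 → ¬ IsKst G 2 2 S T
  K22freeU2V1 : ∀ S T : Finset V, S ⊆ U2 → T ⊆ V1 → ¬ IsKst G 2 2 S T
  degU1 : ∀ u ∈ U1, degS G u V2 ≤ s - 1
  degU2 : ∀ u ∈ U2, degS G u V1 ≤ s - 1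
  degV1 : ∀ v ∈ V1, degS G v U2 ≤ s - 1
  degV2 : ∀ v ∈ V2, degS G v U1 ≤ s - 1

/-- The vertex set `W` of a copy of `K_{s,t}` is crossing. -/
def Crossing (U1 V1 U2 V2 W : Finset V) : Prop :=
  (W ∩ (U1 ∪ V1)).Nonempty ∧ (W ∩ (U2 ∪ V2)).Nonempty

/-- `W` is crossing from the set `A`, where `AD = A^D` is the diagonal set of `A`
and `AM = A^M` is the opposite middle set of `A`. -/
def CrossingFrom (W A AD AM : Finset V) : Prop :=
  (W ∩ A).card = 1 ∧
    (2 ≤ (W ∩ AD).card ∨ ((W ∩ AD).card = 1 ∧ (W ∩ AM).Nonempty))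

/-- `W` is of Type 1 (crossing from `A`), where `AD = A^D`, `AN = A^N`,
`ANM = (A^N)^M`. -/
def Type1From (s t : ℕ) (W AD AN ANM : Finset V) : Prop :=
  ∃ p : ℕ, 2 ≤ p ∧ p ≤ s - 1 ∧ (W ∩ ANM).card = s - 1 ∧
    (W ∩ AN).card = t - p ∧ (W ∩ AD).card = p

/-- `W` is of Type 2 (crossing from `A`), where `AD = A^D`, `AM = A^M`,
`AND = (A^N)^D`. -/
def Type2From (s t : ℕ) (W AD AM AND : Finset V) : Prop :=
  ∃ p : ℕ, 1 ≤ p ∧ p ≤ s - 1 ∧ (W ∩ AND).card = t - 1 ∧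
    (W ∩ AM).card = s - p ∧ (W ∩ AD).card = p

/-- The class sizes of a `K_{s,t}` with `aᵢ` vertices in `Uᵢ` and `bᵢ` vertices in `Vᵢ`: up to an
error controlled by its middle vertices, `a₁ - b₁` is `r (t - s)` and `a₁ + b₁` is `c (s + t)` with
`c = r + 2 m` of the same parity as `r`. -/
lemma exists_side_one_approx {s t a0 a1 a2 b0 b1 b2 : ℕ} (ht : 2 * s + 1 ≤ t)
    (hs : 1 ≤ s) (ha0 : a0 ≤ s - 1) (hb0 : b0 ≤ s - 1) (h00 : a0 = 0 ∨ b0 = 0)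
    (h12 : a1 = 0 ∨ b2 ≤ s - 1) (h12' : b2 = 0 ∨ a1 ≤ s - 1)
    (h21 : a2 = 0 ∨ b1 ≤ s - 1) (h21' : b1 = 0 ∨ a2 ≤ s - 1)
    (hk12 : a1 ≤ 1 ∨ b2 ≤ 1) (hk21 : a2 ≤ 1 ∨ b1 ≤ 1)
    (hcard : (a0 + a1 + a2 = s ∧ b0 + b1 + b2 = t) ∨
      (a0 + a1 + a2 = t ∧ b0 + b1 + b2 = s)) :
    ∃ r m : ℤ,
      (-b0 ≤ r * (t - s) - (a1 - b1) ∧ r * (t - s) - (a1 - b1) ≤ a0) ∧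
      (-(a0 + b0) ≤ (r + 2 * m) * (s + t) - (a1 + b1) ∧
        (r + 2 * m) * (s + t) - (a1 + b1) ≤ (2 * (a0 + b0) : ℤ)) := by
  have key : ((-b0 : ℤ) ≤ -(a1 - b1) ∧ (-(a1 - b1) : ℤ) ≤ a0 ∧
        (-(a0 + b0) : ℤ) ≤ -(a1 + b1)) ∨
      ((-b0 : ℤ) ≤ (t - s) - (a1 - b1) ∧ ((t - s) - (a1 - b1) : ℤ) ≤ a0 ∧
        (-(a0 + b0) : ℤ) ≤ (s + t) - (a1 + b1) ∧
        ((s + t) - (a1 + b1) : ℤ) ≤ 2 * (a0 + b0)) ∨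
      ((-b0 : ℤ) ≤ -(t - s) - (a1 - b1) ∧ (-(t - s) - (a1 - b1) : ℤ) ≤ a0 ∧
        (-(a0 + b0) : ℤ) ≤ (s + t) - (a1 + b1) ∧
        ((s + t) - (a1 + b1) : ℤ) ≤ 2 * (a0 + b0)) := by
    rcases h00 with rfl | rfl <;> rcases hcard with ⟨_, _⟩ | ⟨_, _⟩ <;>
      rcases h12 with rfl | _ <;> rcases h21 with rfl | _ <;>
      rcases h12' with rfl | _ <;> rcases h21' with rfl | _ <;>
      rcases hk12 with _ | _ <;> rcases hk21 with _ | _ <;> omega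
  rcases key with h | h | h
  · exact ⟨0, 0, by constructor <;> linarith, by constructor <;> linarith⟩
  · exact ⟨1, 0, by constructor <;> linarith, by constructor <;> linarith⟩
  · exact ⟨-1, 1, by constructor <;> linarith, by constructor <;> linarith⟩

lemma card_le_of_degS_le {G : SimpleGraph V} {A B X Y : Finset V} {d : ℕ}
    (hX : ∀ u ∈ X, degS G u Y ≤ d) (hAB : ∀ u ∈ A, ∀ v ∈ B, G.Adj u v) :
    (A ∩ X).card = 0 ∨ (B ∩ Y).card ≤ d := by
  rcases (A ∩ X).eq_empty_or_nonempty with h | ⟨u, hu⟩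
  · simp [h]
  · right
    rw [mem_inter] at hu
    refine le_trans (card_le_card fun v hv => ?_) (hX u hu.2)
    rw [mem_inter] at hv
    exact mem_filter.2 ⟨hv.2, hAB u hu.1 v hv.1⟩

lemma card_le_one_of_K22free {G : SimpleGraph V} {A B X Y : Finset V}
    (hXY : ∀ S T : Finset V, S ⊆ X → T ⊆ Y → ¬ IsKst G 2 2 S T) (hdisj : Disjoint A B)
    (hAB : ∀ u ∈ A, ∀ v ∈ B, G.Adj u v) :
    (A ∩ X).card ≤ 1 ∨ (B ∩ Y).card ≤ 1 := by
  by_contra! h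
  obtain ⟨S, hS, hS2⟩ := exists_subset_card_eq (Nat.succ_le_of_lt h.1)
  obtain ⟨T, hT, hT2⟩ := exists_subset_card_eq (Nat.succ_le_of_lt h.2)
  have hSA : S ⊆ A := hS.trans inter_subset_left
  have hTB : T ⊆ B := hT.trans inter_subset_left
  exact hXY S T (hS.trans inter_subset_right) (hT.trans inter_subset_right)
    ⟨hdisj.mono hSA hTB, hS2, hT2, fun u hu v hv => hAB u (hSA hu) v (hTB hv)⟩

lemma card_eq_of_subset_three {A X Y Z : Finset V} (hXY : Disjoint X Y) (hXZ : Disjoint X Z)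
    (hYZ : Disjoint Y Z) (hA : A ⊆ X ∪ Y ∪ Z) :
    (A ∩ X).card + (A ∩ Y).card + (A ∩ Z).card = A.card := by
  rw [← card_union_of_disjoint (hXY.mono inter_subset_right inter_subset_right),
    ← inter_union_distrib_left, ← card_union_of_disjoint, ← inter_union_distrib_left,
    inter_eq_left.2 hA]
  exact (disjoint_union_left.2 ⟨hXZ, hYZ⟩).mono inter_subset_right inter_subset_right

lemma StructH.exists_side_one_approx {G : SimpleGraph V} {s t k : ℕ}
    {U0 U1 U2 V0 V1 V2 A B : Finset V} (hH : StructH G s t k U0 U1 U2 V0 V1 V2)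
    (hA : A ⊆ U0 ∪ U1 ∪ U2) (hB : B ⊆ V0 ∪ V1 ∪ V2)
    (hAB : ∀ u ∈ A, ∀ v ∈ B, G.Adj u v)
    (hcard : (A.card = s ∧ B.card = t) ∨ (A.card = t ∧ B.card = s)) :
    ∃ r m : ℤ,
      (-(((A ∪ B) ∩ V0).card : ℤ) ≤
          r * (t - s) - (((A ∪ B) ∩ U1).card - ((A ∪ B) ∩ V1).card) ∧
        r * (t - s) - (((A ∪ B) ∩ U1).card - ((A ∪ B) ∩ V1).card) ≤
          (((A ∪ B) ∩ U0).card : ℤ)) ∧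
      (-(((A ∪ B) ∩ U0).card + ((A ∪ B) ∩ V0).card : ℤ) ≤
          (r + 2 * m) * (s + t) - (((A ∪ B) ∩ U1).card + ((A ∪ B) ∩ V1).card) ∧
        (r + 2 * m) * (s + t) - (((A ∪ B) ∩ U1).card + ((A ∪ B) ∩ V1).card) ≤
          (2 * (((A ∪ B) ∩ U0).card + ((A ∪ B) ∩ V0).card) : ℤ)) := by
  have hUV := hH.bip.1
  have interU : ∀ X ⊆ U0 ∪ U1 ∪ U2, (A ∪ B) ∩ X = A ∩ X := fun X hX => by
    rw [union_inter_distrib_right, disjoint_iff_inter_eq_empty.1 (hUV.symm.mono hB hX),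
      union_empty]
  have interV : ∀ X ⊆ V0 ∪ V1 ∪ V2, (A ∪ B) ∩ X = B ∩ X := fun X hX => by
    rw [union_inter_distrib_right, disjoint_iff_inter_eq_empty.1 (hUV.mono hA hX),
      empty_union]
  have hBA : ∀ v ∈ B, ∀ u ∈ A, G.Adj v u := fun v hv u hu => (hAB u hu v hv).symm
  have hdisj : Disjoint A B := hUV.mono hA hB
  rw [interU U0 (subset_union_left.trans subset_union_left),
    interU U1 (subset_union_right.trans subset_union_left),
    interV V0 (subset_union_left.trans subset_union_left),
    interV V1 (subset_union_right.trans subset_union_left)]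
  refine PaperTiling.exists_side_one_approx hH.ht hH.hs
    ((card_le_card inter_subset_right).trans_eq hH.cardU0)
    ((card_le_card inter_subset_right).trans_eq hH.cardV0) ?_
    (card_le_of_degS_le hH.degU1 hAB) (card_le_of_degS_le hH.degV2 hBA)
    (card_le_of_degS_le hH.degU2 hAB) (card_le_of_degS_le hH.degV1 hBA)
    (card_le_one_of_K22free hH.K22freeU1V2 hdisj hAB)
    (card_le_one_of_K22free hH.K22freeU2V1 hdisj hAB) ?_
  · simp only [card_eq_zero]
    by_contra! h
    obtain ⟨⟨u, hu⟩, ⟨v, hv⟩⟩ := h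
    rw [mem_inter] at hu hv
    exact hH.emptyU0V0 u hu.2 v hv.2 (hAB u hu.1 v hv.1)
  · rwa [card_eq_of_subset_three hH.hU01 hH.hU02 hH.hU12 hA,
      card_eq_of_subset_three hH.hV01 hH.hV02 hH.hV12 hB]

/-- Each colour class of a bipartite graph contains exactly one side of a `K_{s,t}`. -/
lemma IsKst.sides {G : SimpleGraph V} {s t : ℕ} {X Y S T : Finset V} (hs : 1 ≤ s) (ht : 1 ≤ t)
    (hbip : IsBipartition G X Y) (hK : IsKst G s t S T) :
    (S ⊆ X ∧ T ⊆ Y) ∨ (T ⊆ X ∧ S ⊆ Y) := by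
  obtain ⟨hXY, -, hadj⟩ := hbip
  obtain ⟨-, hS, hT, hST⟩ := hK
  obtain ⟨u, hu⟩ : S.Nonempty := card_pos.1 (by omega)
  obtain ⟨v, hv⟩ : T.Nonempty := card_pos.1 (by omega)
  have hnot : ∀ {x}, x ∈ X → x ∉ Y := fun hx hy => disjoint_left.1 hXY hx hy
  rcases hadj u v (hST u hu v hv) with ⟨huX, hvY⟩ | ⟨huY, hvX⟩
  · refine .inl ⟨fun x hx => ?_, fun y hy => ?_⟩
    · rcases hadj x v (hST x hx v hv) with h | h
      · exact h.1
      · exact absurd hvY (hnot h.2)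
    · rcases hadj u y (hST u hu y hy) with h | h
      · exact h.2
      · exact absurd h.1 (hnot huX)
  · refine .inr ⟨fun y hy => ?_, fun x hx => ?_⟩
    · rcases hadj u y (hST u hu y hy) with h | h
      · exact absurd huY (hnot h.1)
      · exact h.2
    · rcases hadj x v (hST x hx v hv) with h | h
      · exact absurd h.2 (hnot hvX)
      · exact h.1

lemma IsKstTiling.sum_card_inter {G : SimpleGraph V} {s t : ℕ}
    {𝒯 : Finset (Finset V × Finset V)} (h𝒯 : IsKstTiling G s t 𝒯) (X : Finset V) :
    ∑ P ∈ 𝒯, (((P.1 ∪ P.2) ∩ X).card : ℤ) = X.card := by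
  obtain ⟨-, hdisj, hcover⟩ := h𝒯
  rw [← Nat.cast_sum, ← card_biUnion fun P hP Q hQ hPQ =>
    (hdisj hP hQ hPQ).mono inter_subset_left inter_subset_left]
  congr 2
  rw [← biUnion_inter, ← sup_eq_biUnion, hcover, univ_inter]

/-- Under the structure hypotheses, `G` has no `K_{s,t}`-tiling. -/
theorem StructH.not_isKstTiling {G : SimpleGraph V} {s t k : ℕ}
    {U0 U1 U2 V0 V1 V2 : Finset V} (hH : StructH G s t k U0 U1 U2 V0 V1 V2)
    (𝒯 : Finset (Finset V × Finset V)) : ¬ IsKstTiling G s t 𝒯 := by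
  intro h𝒯
  have htile : ∀ P : Finset V × Finset V, ∃ r m : ℤ, P ∈ 𝒯 →
      (-(((P.1 ∪ P.2) ∩ V0).card : ℤ) ≤
          r * (t - s) - (((P.1 ∪ P.2) ∩ U1).card - ((P.1 ∪ P.2) ∩ V1).card) ∧
        r * (t - s) - (((P.1 ∪ P.2) ∩ U1).card - ((P.1 ∪ P.2) ∩ V1).card) ≤
          (((P.1 ∪ P.2) ∩ U0).card : ℤ)) ∧
      (-(((P.1 ∪ P.2) ∩ U0).card + ((P.1 ∪ P.2) ∩ V0).card : ℤ) ≤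
          (r + 2 * m) * (s + t) - (((P.1 ∪ P.2) ∩ U1).card + ((P.1 ∪ P.2) ∩ V1).card) ∧
        (r + 2 * m) * (s + t) - (((P.1 ∪ P.2) ∩ U1).card + ((P.1 ∪ P.2) ∩ V1).card) ≤
          (2 * (((P.1 ∪ P.2) ∩ U0).card + ((P.1 ∪ P.2) ∩ V0).card) : ℤ)) := by
    intro P
    by_cases hP : P ∈ 𝒯
    · have hK := h𝒯.1 P hP
      obtain ⟨-, hS, hT, hadj⟩ := id hK
      rcases hK.sides hH.hs (by have := hH.ht; omega) hH.bip with ⟨hSU, hTV⟩ | ⟨hTU, hSV⟩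
      · obtain ⟨r, m, h⟩ := hH.exists_side_one_approx hSU hTV hadj (.inl ⟨hS, hT⟩)
        exact ⟨r, m, fun _ => h⟩
      · obtain ⟨r, m, h⟩ := hH.exists_side_one_approx hTU hSV
          (fun u hu v hv => (hadj v hv u hu).symm) (.inr ⟨hT, hS⟩)
        rw [union_comm] at h
        exact ⟨r, m, fun _ => h⟩
    · exact ⟨0, 0, fun h => absurd h hP⟩
  choose r m h using htile
  have h1 := sum_le_sum fun P hP => (h P hP).1.1
  have h2 := sum_le_sum fun P hP => (h P hP).1.2
  have h3 := sum_le_sum fun P hP => (h P hP).2.1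
  have h4 := sum_le_sum fun P hP => (h P hP).2.2
  simp only [sum_sub_distrib, sum_add_distrib, sum_neg_distrib, ← sum_mul, ← mul_sum,
    h𝒯.sum_card_inter] at h1 h2 h3 h4
  rw [hH.cardU1, hH.cardV1] at h1 h2 h3 h4
  rw [hH.cardV0] at h1 h3 h4
  rw [hH.cardU0] at h2 h3 h4
  generalize ∑ P ∈ 𝒯, r P = R at h1 h2 h3 h4
  generalize ∑ P ∈ 𝒯, m P = M at h3 h4
  have hs := hH.hs
  have ht := hH.ht
  have hR : R = 0 := by
    have hlt : R < 1 := by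
      by_contra! hR
      have := mul_le_mul_of_nonneg_right hR (show (0 : ℤ) ≤ t - s by omega)
      omega
    have hgt : -1 < R := by
      by_contra! hR
      have := mul_le_mul_of_nonneg_right hR (show (0 : ℤ) ≤ t - s by omega)
      omega
    omega
  subst hR
  have hexp : (0 + 2 * M) * (s + t : ℤ) =
      2 * ((M - k) * (s + t)) + 2 * ((k * (s + t) : ℕ) : ℤ) := by
    push_cast
    ring
  rw [hexp] at h3 h4
  rcases le_or_gt (M - k) 0 with hM | hM
  · have := mul_le_mul_of_nonneg_right hM (show (0 : ℤ) ≤ s + t by omega)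
    omega
  · have := mul_le_mul_of_nonneg_right (Int.add_one_le_of_lt hM) (show (0 : ℤ) ≤ s + t by omega)
    omega

/-- Claim 3.4, forbidden configurations: under the structure
hypotheses (H), if `𝒯` is a `K_{s,t}`-tiling of `G` minimizing the number of
crossing copies, then for `i = 1,2`: if `𝒯` contains a Type 2 crossing copy
from `U_i` or `V_i`, it contains no Type 2 crossing copy from `U_{3−i}` or
`V_{3−i}`. -/
theorem claim_forbidden {V : Type*} [Fintype V] [DecidableEq V]
    (G : SimpleGraph V) (s t k : ℕ) (U0 U1 U2 V0 V1 V2 : Finset V)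
    (hH : StructH G s t k U0 U1 U2 V0 V1 V2)
    (𝒯 : Finset (Finset V × Finset V))
    (h𝒯 : IsKstTiling G s t 𝒯)
    (hmin : ∀ 𝒯' : Finset (Finset V × Finset V), IsKstTiling G s t 𝒯' →
      (𝒯.filter fun P => Crossing U1 V1 U2 V2 (P.1 ∪ P.2)).card ≤
        (𝒯'.filter fun P => Crossing U1 V1 U2 V2 (P.1 ∪ P.2)).card) :
    ((∃ P ∈ 𝒯,
        (CrossingFrom (P.1 ∪ P.2) U1 V2 V0 ∧
          Type2From s t (P.1 ∪ P.2) V2 V0 U2) ∨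
        (CrossingFrom (P.1 ∪ P.2) V1 U2 U0 ∧
          Type2From s t (P.1 ∪ P.2) U2 U0 V2)) →
      ∀ P ∈ 𝒯,
        ¬ (CrossingFrom (P.1 ∪ P.2) U2 V1 V0 ∧
            Type2From s t (P.1 ∪ P.2) V1 V0 U1) ∧
        ¬ (CrossingFrom (P.1 ∪ P.2) V2 U1 U0 ∧
            Type2From s t (P.1 ∪ P.2) U1 U0 V1)) ∧
    ((∃ P ∈ 𝒯,
        (CrossingFrom (P.1 ∪ P.2) U2 V1 V0 ∧
          Type2From s t (P.1 ∪ P.2) V1 V0 U1) ∨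
        (CrossingFrom (P.1 ∪ P.2) V2 U1 U0 ∧
          Type2From s t (P.1 ∪ P.2) U1 U0 V1)) →
      ∀ P ∈ 𝒯,
        ¬ (CrossingFrom (P.1 ∪ P.2) U1 V2 V0 ∧
            Type2From s t (P.1 ∪ P.2) V2 V0 U2) ∧
        ¬ (CrossingFrom (P.1 ∪ P.2) V1 U2 U0 ∧
            Type2From s t (P.1 ∪ P.2) U2 U0 V2)) := by
  exact absurd h𝒯 (hH.not_isKstTiling 𝒯)

end PaperTiling
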